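/- arXiv:1601.06037 — 2 statements merged into one kernel-verified Lean document; each statement's English description precedes it below -/
import Mathlib

section
/- Let n, m be positive integers, let X ∈ F_q^{n×m} be a matrix of rank r_X, and let r, r_B be nonnegative integers with r ≤ m. Suppose that for each integer h with max{0, r − (m − r_X)} ≤ h ≤ min{r, r_X} a subspace V_h ⊆ F_q^m is given with dim V_h = r and dim(V_h ∩ row(X)) = h. Then the number of matrices B ∈ F_q^{n×m} with rank(B) = r_B and rank(X + B) = r equals Σ_{h = max{0, r − (m − r_X)}}^{min{r, r_X}} q^{(r−h)(r_X−h)} · [m − r_X choose r − h]_q · [r_X choose h]_q · |{B ∈ F_q^{n×m} : rank(B) = r_B and row(X + B) = V_h}|. -/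
/-- The Gaussian binomial coefficient `[a choose b]_q`:
`∏_{i=0}^{b-1} (q^a - q^i)/(q^b - q^i)` for `b ≤ a`, and `0` for `b > a`
(note that for `b > a` the numerator below contains the factor `q^a - q^a = 0`). -/
noncomputable def gaussBinom (q a b : ℕ) : ℕ :=
  (∏ i ∈ Finset.range b, (q ^ a - q ^ i)) / (∏ i ∈ Finset.range b, (q ^ b - q ^ i))

/-- The row space of a matrix `M ∈ F^{n×m}`, i.e. the span of its rows: this is the
range of the linear map `x ↦ x ᵥ* M` from `F^n` to `F^m`. -/
noncomputable def rowSpace {F : Type*} [Field F] {n m : ℕ}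
    (M : Matrix (Fin n) (Fin m) F) : Submodule F (Fin m → F) :=
  LinearMap.range M.vecMulLinear

theorem prod_pow_sub_pow_pos {q : ℕ} (hq : 1 < q) (b : ℕ) :
    0 < ∏ i ∈ Finset.range b, (q ^ b - q ^ i) :=
  Finset.prod_pos fun _ hi =>
    Nat.sub_pos_of_lt (Nat.pow_lt_pow_right hq (Finset.mem_range.1 hi))

section CardFamilies

variable {K V : Type*} [Field K] [Finite K] [AddCommGroup V] [Module K V] [FiniteDimensional K V]

theorem card_linearIndependent_fin (k : ℕ) :
    Nat.card {s : Fin k → V // LinearIndependent K s} =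
      ∏ i ∈ Finset.range k, (Nat.card K ^ Module.finrank K V - Nat.card K ^ i) := by
  have := Fintype.ofFinite K
  have : Finite V := Module.finite_of_finite K
  by_cases hk : k ≤ Module.finrank K V
  · rw [card_linearIndependent hk, Nat.card_eq_fintype_card,
      Finset.prod_range (fun i => Fintype.card K ^ Module.finrank K V - Fintype.card K ^ i)]
  · rw [Finset.prod_eq_zero (Finset.mem_range.2 (not_le.1 hk)) (Nat.sub_self (_ ^ _))]
    have : IsEmpty {s : Fin k → V // LinearIndependent K s} :=
      ⟨fun s => hk (by simpa using s.2.fintype_card_le_finrank)⟩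
    exact Nat.card_of_isEmpty

theorem card_linearIndependent_mem (U : Submodule K V) (k : ℕ) :
    Nat.card {s : Fin k → V // LinearIndependent K s ∧ ∀ i, s i ∈ U} =
      ∏ i ∈ Finset.range k, (Nat.card K ^ Module.finrank K U - Nat.card K ^ i) := by
  rw [← card_linearIndependent_fin]
  refine Nat.card_congr
    { toFun s := ⟨fun i => ⟨s.1 i, s.2.2 i⟩, LinearIndependent.of_comp U.subtype s.2.1⟩
      invFun s := ⟨fun i => (s.1 i : V),
        s.2.map' U.subtype U.ker_subtype, fun i => (s.1 i).2⟩
      left_inv _ := rfl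
      right_inv _ := rfl }

theorem card_linearIndependent_comp {Q : Type*} [AddCommGroup Q] [Module K Q] (f : V →ₗ[K] Q)
    (k : ℕ) :
    Nat.card {s : Fin k → V // LinearIndependent K (f ∘ s)} =
      Nat.card K ^ (Module.finrank K (LinearMap.ker f) * k) *
        ∏ i ∈ Finset.range k,
          (Nat.card K ^ (Module.finrank K V - Module.finrank K (LinearMap.ker f)) -
            Nat.card K ^ i) := by
  obtain ⟨C, hC⟩ := (LinearMap.ker f).exists_isCompl
  have hdim : Module.finrank K V - Module.finrank K (LinearMap.ker f) = Module.finrank K C := by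
    have := Submodule.finrank_add_eq_of_isCompl hC
    omega
  rw [hdim, ← card_linearIndependent_fin, pow_mul,
    ← Module.natCard_eq_pow_finrank (K := K) (V := LinearMap.ker f)]
  have hinj : LinearMap.ker (f ∘ₗ C.subtype) = ⊥ := by
    rw [LinearMap.ker_comp, Submodule.eq_bot_iff]
    intro x hx
    exact Subtype.ext ((Submodule.disjoint_def.1 hC.disjoint) x hx x.2)
  let e := Submodule.prodEquivOfIsCompl _ _ hC
  have hfe (x : V) : f x = (f ∘ₗ C.subtype) (e.symm x).2 := by
    conv_lhs => rw [← e.apply_symm_apply x, Submodule.coe_prodEquivOfIsCompl']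
    simp
  have hE (s : Fin k → V) :
      LinearIndependent K (f ∘ s) ↔ LinearIndependent K fun i => (e.symm (s i)).2 := by
    have hfs : f ∘ s = (f ∘ₗ C.subtype) ∘ fun i => (e.symm (s i)).2 := funext fun i => hfe (s i)
    rw [hfs, LinearMap.linearIndependent_iff _ hinj]
  have key : {s : Fin k → V // LinearIndependent K (f ∘ s)} ≃
      (Fin k → LinearMap.ker f) × {s : Fin k → C // LinearIndependent K s} :=
    { toFun s := (fun i => (e.symm (s.1 i)).1, ⟨fun i => (e.symm (s.1 i)).2, (hE s.1).1 s.2⟩)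
      invFun p := ⟨fun i => e (p.1 i, p.2.1 i), (hE _).2 (by
        simp only [e.symm_apply_apply]
        exact p.2.2)⟩
      left_inv s := Subtype.ext (funext fun i => by simp only [Prod.mk.eta, e.apply_symm_apply])
      right_inv p := by simp only [e.symm_apply_apply] }
  rw [Nat.card_congr key, Nat.card_prod, Nat.card_fun, Nat.card_eq_fintype_card (α := Fin k),
    Fintype.card_fin]

theorem card_linearIndependent_mkQ_mem (U W : Submodule K V) (k : ℕ) :
    Nat.card {s : Fin k → V // LinearIndependent K (U.mkQ ∘ s) ∧ ∀ i, s i ∈ W} =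
      Nat.card K ^ (Module.finrank K (W ⊓ U : Submodule K V) * k) *
        ∏ i ∈ Finset.range k,
          (Nat.card K ^ (Module.finrank K W - Module.finrank K (W ⊓ U : Submodule K V)) -
            Nat.card K ^ i) := by
  have hker : Module.finrank K (LinearMap.ker (U.mkQ ∘ₗ W.subtype)) =
      Module.finrank K (W ⊓ U : Submodule K V) := by
    rw [LinearMap.ker_comp, Submodule.ker_mkQ, ← Submodule.map_comap_subtype]
    exact (LinearEquiv.finrank_eq (Submodule.equivMapOfInjective _ W.injective_subtype _))
  rw [← hker, ← card_linearIndependent_comp]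
  exact Nat.card_congr
    { toFun s := ⟨fun i => ⟨s.1 i, s.2.2 i⟩, s.2.1⟩
      invFun s := ⟨fun i => (s.1 i : V), s.2, fun i => (s.1 i).2⟩
      left_inv _ := rfl
      right_inv _ := rfl }

omit [Finite K] in
theorem finrank_span_sup_span {U : Submodule K V} {h k : ℕ} {a : Fin h → V} {b : Fin k → V}
    (ha : LinearIndependent K a) (haU : ∀ i, a i ∈ U) (hb : LinearIndependent K (U.mkQ ∘ b)) :
    Module.finrank K (Submodule.span K (Set.range a) ⊔ Submodule.span K (Set.range b) :
      Submodule K V) = h + k ∧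
    Module.finrank K ((Submodule.span K (Set.range a) ⊔ Submodule.span K (Set.range b)) ⊓ U :
      Submodule K V) = h := by
  have hAU : Submodule.span K (Set.range a) ≤ U := by
    rw [Submodule.span_le]
    rintro _ ⟨i, rfl⟩
    exact haU i
  have hdisj : Submodule.span K (Set.range b) ⊓ U = ⊥ := by
    have := Submodule.range_ker_disjoint hb
    rw [Submodule.ker_mkQ] at this
    exact this.eq_bot
  have hA : Module.finrank K (Submodule.span K (Set.range a)) = h := by
    simpa using finrank_span_eq_card ha
  have hB : Module.finrank K (Submodule.span K (Set.range b)) = k := by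
    simpa using finrank_span_eq_card (LinearIndependent.of_comp U.mkQ hb)
  constructor
  · have hAB : Submodule.span K (Set.range a) ⊓ Submodule.span K (Set.range b) = ⊥ :=
      eq_bot_iff.2 (hdisj ▸ le_inf inf_le_right (inf_le_left.trans hAU))
    have := Submodule.finrank_sup_add_finrank_inf_eq (Submodule.span K (Set.range a))
      (Submodule.span K (Set.range b))
    rw [hAB, finrank_bot, hA, hB] at this
    exact this
  · rw [sup_inf_assoc_of_le _ hAU, hdisj, sup_bot_eq, hA]

/-- Double counting of adapted bases of the subspaces `W` with `dim W = h + k` and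
`dim (W ⊓ U) = h`. -/
theorem card_submodule_inf_mul (U : Submodule K V) (h k : ℕ) :
    Nat.card {W : Submodule K V // Module.finrank K W = h + k ∧
        Module.finrank K (W ⊓ U : Submodule K V) = h} *
      ((∏ i ∈ Finset.range h, (Nat.card K ^ h - Nat.card K ^ i)) *
        (Nat.card K ^ (h * k) * ∏ i ∈ Finset.range k, (Nat.card K ^ k - Nat.card K ^ i))) =
    (∏ i ∈ Finset.range h, (Nat.card K ^ Module.finrank K U - Nat.card K ^ i)) *
      (Nat.card K ^ (Module.finrank K U * k) *
        ∏ i ∈ Finset.range k,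
          (Nat.card K ^ (Module.finrank K V - Module.finrank K U) - Nat.card K ^ i)) := by
  have : Finite V := Module.finite_of_finite K
  let T := {a : Fin h → V // LinearIndependent K a ∧ ∀ i, a i ∈ U} ×
    {b : Fin k → V // LinearIndependent K (U.mkQ ∘ b) ∧ ∀ i, b i ∈ (⊤ : Submodule K V)}
  let S := {W : Submodule K V // Module.finrank K W = h + k ∧
        Module.finrank K (W ⊓ U : Submodule K V) = h}
  have : Finite (Submodule K V) := Finite.of_injective _ SetLike.coe_injective
  have : Fintype S := Fintype.ofFinite S
  have hT : Nat.card T = _ := Nat.card_prod _ _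
  rw [card_linearIndependent_mem, card_linearIndependent_mkQ_mem, top_inf_eq, finrank_top] at hT
  rw [← hT]
  let f : T → S := fun p => ⟨_, finrank_span_sup_span p.1.2.1 p.1.2.2 p.2.2.1⟩
  have hfib (W : S) : Nat.card {p : T // f p = W} =
      (∏ i ∈ Finset.range h, (Nat.card K ^ h - Nat.card K ^ i)) *
        (Nat.card K ^ (h * k) * ∏ i ∈ Finset.range k, (Nat.card K ^ k - Nat.card K ^ i)) := by
    obtain ⟨W, hW, hWU⟩ := W
    have h1 := card_linearIndependent_mem (W ⊓ U) h
    have h2 := card_linearIndependent_mkQ_mem U W k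
    rw [hWU] at h1
    rw [hW, hWU, Nat.add_sub_cancel_left] at h2
    rw [← h1, ← h2, ← Nat.card_prod]
    refine Nat.card_congr
      { toFun p := (⟨p.1.1.1, p.1.1.2.1, fun i => ⟨?_, p.1.1.2.2 i⟩⟩,
          ⟨p.1.2.1, p.1.2.2.1, fun i => ?_⟩)
        invFun p := ⟨(⟨p.1.1, p.1.2.1, fun i => (p.1.2.2 i).2⟩,
          ⟨p.2.1, p.2.2.1, fun _ => trivial⟩), Subtype.ext ?_⟩
        left_inv _ := rfl
        right_inv _ := rfl }
    · have := congrArg Subtype.val p.2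
      exact this.le (Submodule.mem_sup_left (Submodule.subset_span ⟨i, rfl⟩))
    · have := congrArg Subtype.val p.2
      exact this.le (Submodule.mem_sup_right (Submodule.subset_span ⟨i, rfl⟩))
    · refine Submodule.eq_of_le_of_finrank_eq (sup_le ?_ ?_) ?_
      · rw [Submodule.span_le]
        rintro _ ⟨i, rfl⟩
        exact (p.1.2.2 i).1
      · rw [Submodule.span_le]
        rintro _ ⟨i, rfl⟩
        exact p.2.2.2 i
      · rw [hW]
        exact (finrank_span_sup_span p.1.2.1 (fun i => (p.1.2.2 i).2) p.2.2.1).1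
  rw [Nat.card_congr (Equiv.sigmaFiberEquiv f).symm, Nat.card_sigma,
    Finset.sum_congr rfl (fun W _ => hfib W), Finset.sum_const, smul_eq_mul, Finset.card_univ,
    Nat.card_eq_fintype_card]

theorem gaussBinom_mul (K : Type*) [Field K] [Finite K] (a b : ℕ) :
    gaussBinom (Nat.card K) a b *
        ∏ i ∈ Finset.range b, (Nat.card K ^ b - Nat.card K ^ i) =
      ∏ i ∈ Finset.range b, (Nat.card K ^ a - Nat.card K ^ i) := by
  have := card_submodule_inf_mul (⊤ : Submodule K (Fin a → K)) b 0
  rw [finrank_top, Module.finrank_fin_fun] at this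
  simp only [mul_zero, pow_zero, Finset.range_zero, Finset.prod_empty, mul_one] at this
  exact Nat.div_mul_cancel (Dvd.intro_left _ this)

theorem card_submodule_inf (U : Submodule K V) {h : ℕ} (hh : h ≤ Module.finrank K U) (k : ℕ) :
    Nat.card {W : Submodule K V // Module.finrank K W = h + k ∧
        Module.finrank K (W ⊓ U : Submodule K V) = h} =
      Nat.card K ^ (k * (Module.finrank K U - h)) *
        gaussBinom (Nat.card K) (Module.finrank K V - Module.finrank K U) k *
        gaussBinom (Nat.card K) (Module.finrank K U) h := by
  have hq : 1 < Nat.card K := Finite.one_lt_card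
  have hmul := card_submodule_inf_mul U h k
  have hpos := Nat.mul_pos (prod_pow_sub_pow_pos hq h) (Nat.mul_pos
    (pow_pos (zero_lt_one.trans hq) (h * k)) (prod_pow_sub_pow_pos hq k))
  refine Nat.eq_of_mul_eq_mul_right hpos (hmul.trans ?_)
  have hexp : Module.finrank K U * k = k * (Module.finrank K U - h) + h * k := by
    obtain ⟨d, hd⟩ := Nat.exists_eq_add_of_le hh
    rw [hd, Nat.add_sub_cancel_left]
    ring
  rw [← gaussBinom_mul K _ h, ← gaussBinom_mul K (_ - _) k, hexp, pow_add]
  ring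

end CardFamilies

section Transitivity

variable {K V : Type*} [Field K] [AddCommGroup V] [Module K V] [FiniteDimensional K V]

/-- A pair of subspaces is, up to isomorphism, a pair of coordinate subspaces. -/
theorem exists_linearEquiv_map_eq (U W : Submodule K V) {h a b c : ℕ}
    (hUW : Module.finrank K (W ⊓ U : Submodule K V) = h) (hU : Module.finrank K U = h + a)
    (hW : Module.finrank K W = h + b) (hV : Module.finrank K V = h + a + b + c) :
    ∃ e : ((Fin h → K) × (Fin a → K) × (Fin b → K) × (Fin c → K)) ≃ₗ[K] V,
      Submodule.map e.toLinearMap (Submodule.prod ⊤ (Submodule.prod ⊤ ⊥)) = U ∧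
      Submodule.map e.toLinearMap
        (Submodule.prod ⊤ (Submodule.prod ⊥ (Submodule.prod ⊤ ⊥))) = W := by
  obtain ⟨U₁, hU₁⟩ := Submodule.exists_isCompl ((W ⊓ U).comap U.subtype)
  obtain ⟨W₁, hW₁⟩ := Submodule.exists_isCompl ((W ⊓ U).comap W.subtype)
  obtain ⟨C, hC⟩ := Submodule.exists_isCompl (U ⊔ W)
  have hUsup : (W ⊓ U) ⊔ U₁.map U.subtype = U := by
    have := congrArg (Submodule.map U.subtype) hU₁.sup_eq_top
    rwa [Submodule.map_sup, Submodule.map_comap_subtype, inf_eq_right.2 inf_le_right,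
      Submodule.map_top, Submodule.range_subtype] at this
  have hWsup : (W ⊓ U) ⊔ W₁.map W.subtype = W := by
    have := congrArg (Submodule.map W.subtype) hW₁.sup_eq_top
    rwa [Submodule.map_sup, Submodule.map_comap_subtype, inf_eq_right.2 inf_le_left,
      Submodule.map_top, Submodule.range_subtype] at this
  have hUd : Module.finrank K U₁ = a := by
    have h1 := Submodule.finrank_add_eq_of_isCompl hU₁
    rw [(Submodule.comapSubtypeEquivOfLe (inf_le_right : W ⊓ U ≤ U)).finrank_eq] at h1
    omega
  have hWd : Module.finrank K W₁ = b := by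
    have h1 := Submodule.finrank_add_eq_of_isCompl hW₁
    rw [(Submodule.comapSubtypeEquivOfLe (inf_le_left : W ⊓ U ≤ W)).finrank_eq] at h1
    omega
  have hCd : Module.finrank K C = c := by
    have h1 := Submodule.finrank_add_eq_of_isCompl hC
    have h2 := Submodule.finrank_sup_add_finrank_inf_eq U W
    rw [inf_comm] at h2
    omega
  obtain ⟨eH⟩ := FiniteDimensional.nonempty_linearEquiv_of_finrank_eq
    (show Module.finrank K (Fin h → K) = Module.finrank K (W ⊓ U : Submodule K V) by simp [hUW])
  obtain ⟨eU⟩ := FiniteDimensional.nonempty_linearEquiv_of_finrank_eq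
    (show Module.finrank K (Fin a → K) = Module.finrank K U₁ by simp [hUd])
  obtain ⟨eW⟩ := FiniteDimensional.nonempty_linearEquiv_of_finrank_eq
    (show Module.finrank K (Fin b → K) = Module.finrank K W₁ by simp [hWd])
  obtain ⟨eC⟩ := FiniteDimensional.nonempty_linearEquiv_of_finrank_eq
    (show Module.finrank K (Fin c → K) = Module.finrank K C by simp [hCd])
  let fH : (Fin h → K) →ₗ[K] V := (W ⊓ U).subtype ∘ₗ eH
  let fU : (Fin a → K) →ₗ[K] V := U.subtype ∘ₗ U₁.subtype ∘ₗ eU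
  let fW : (Fin b → K) →ₗ[K] V := W.subtype ∘ₗ W₁.subtype ∘ₗ eW
  let fC : (Fin c → K) →ₗ[K] V := C.subtype ∘ₗ eC
  have rH : LinearMap.range fH = W ⊓ U := by simp [fH, LinearMap.range_comp]
  have rU : LinearMap.range fU = U₁.map U.subtype := by simp [fU, LinearMap.range_comp]
  have rW : LinearMap.range fW = W₁.map W.subtype := by simp [fW, LinearMap.range_comp]
  have rC : LinearMap.range fC = C := by simp [fC, LinearMap.range_comp]
  let f := fH.coprod (fU.coprod (fW.coprod fC))
  have hsurj : Function.Surjective f := by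
    rw [← LinearMap.range_eq_top]
    simp only [f, LinearMap.range_coprod, rH, rU, rW, rC]
    rw [← hC.sup_eq_top]
    have hsup : U ⊔ W = (W ⊓ U) ⊔ (U₁.map U.subtype ⊔ W₁.map W.subtype) := by
      rw [← sup_assoc, hUsup]
      conv_lhs => rw [← hWsup, ← sup_assoc, sup_eq_left.2 (inf_le_right : W ⊓ U ≤ U)]
    rw [hsup, sup_assoc, sup_assoc]
  have hinj : Function.Injective f :=
    (LinearMap.injective_iff_surjective_of_finrank_eq_finrank (by simp [hV]; ring)).2 hsurj
  refine ⟨LinearEquiv.ofBijective f ⟨hinj, hsurj⟩, ?_, ?_⟩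
  · change Submodule.map f _ = _
    simp only [f, LinearMap.map_coprod_prod, Submodule.map_top, rH, rU, Submodule.map_bot,
      sup_bot_eq, hUsup]
  · change Submodule.map f _ = _
    simp only [f, LinearMap.map_coprod_prod, Submodule.map_top, rH, rW, Submodule.map_bot,
      sup_bot_eq, bot_sup_eq, hWsup]

/-- The stabilizer of `U` acts transitively on the subspaces `W` with given `dim W` and
`dim (W ⊓ U)`. -/
theorem exists_linearEquiv_map_eq_map_eq (U W W' : Submodule K V)
    (hW : Module.finrank K W = Module.finrank K W')
    (hWU : Module.finrank K (W ⊓ U : Submodule K V) =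
      Module.finrank K (W' ⊓ U : Submodule K V)) :
    ∃ g : V ≃ₗ[K] V, Submodule.map (g : V →ₗ[K] V) U = U ∧
      Submodule.map (g : V →ₗ[K] V) W = W' := by
  obtain ⟨a, ha⟩ := Nat.exists_eq_add_of_le
    (Submodule.finrank_mono (inf_le_right : W ⊓ U ≤ U))
  obtain ⟨b, hb⟩ := Nat.exists_eq_add_of_le
    (Submodule.finrank_mono (inf_le_left : W ⊓ U ≤ W))
  obtain ⟨c, hc⟩ := Nat.exists_eq_add_of_le (Submodule.finrank_le (W ⊔ U))
  have hsup := Submodule.finrank_sup_add_finrank_inf_eq W U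
  obtain ⟨e, heU, heW⟩ := exists_linearEquiv_map_eq U W (c := c) rfl ha hb (by omega)
  obtain ⟨e', heU', heW'⟩ := exists_linearEquiv_map_eq U W' (c := c) hWU.symm ha
    (hW.symm.trans hb) (by omega)
  have hmap (S) : Submodule.map (e.symm.trans e').toLinearMap (Submodule.map e.toLinearMap S) =
      Submodule.map e'.toLinearMap S := by
    rw [← Submodule.map_comp, ← LinearEquiv.coe_trans, ← LinearEquiv.trans_assoc,
      LinearEquiv.self_trans_symm, LinearEquiv.refl_trans]
  refine ⟨e.symm.trans e', ?_, ?_⟩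
  · have := hmap (Submodule.prod ⊤ (Submodule.prod ⊤ ⊥))
    rwa [heU, heU'] at this
  · have := hmap (Submodule.prod ⊤ (Submodule.prod ⊥ (Submodule.prod ⊤ ⊥)))
    rwa [heW, heW'] at this

omit [FiniteDimensional K V] in
theorem exists_linearEquiv_comp_eq {E : Type*} [AddCommGroup E] [Module K E]
    [FiniteDimensional K E] (x : E →ₗ[K] V) (g : V ≃ₗ[K] V)
    (hg : Submodule.map (g : V →ₗ[K] V) (LinearMap.range x) = LinearMap.range x) :
    ∃ e : E ≃ₗ[K] E, ∀ v, x (e v) = g (x v) := by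
  obtain ⟨s₀, hs₀⟩ := x.rangeRestrict.exists_rightInverse_of_surjective x.range_rangeRestrict
  obtain ⟨s, hs⟩ := LinearMap.exists_extend s₀
  have hxs (v : V) (hv : v ∈ LinearMap.range x) : x (s v) = v := by
    have h1 : s v = s₀ ⟨v, hv⟩ := LinearMap.congr_fun hs ⟨v, hv⟩
    rw [h1]
    exact congrArg Subtype.val (LinearMap.congr_fun hs₀ ⟨v, hv⟩)
  let f : E →ₗ[K] E := s ∘ₗ (g : V →ₗ[K] V) ∘ₗ x + (LinearMap.id - s ∘ₗ x)
  have hf (v : E) : f v = s (g (x v)) + (v - s (x v)) := rfl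
  have hxf (v : E) : x (f v) = g (x v) := by
    rw [hf, map_add, map_sub, hxs (x v) ⟨v, rfl⟩, sub_self, add_zero]
    exact hxs _ (hg.le ⟨x v, ⟨v, rfl⟩, rfl⟩)
  have hinj : Function.Injective f := by
    rw [← LinearMap.ker_eq_bot, LinearMap.ker_eq_bot']
    intro v hv
    have h0 : x v = 0 := by
      have := hxf v
      rwa [hv, map_zero, eq_comm, LinearEquiv.map_eq_zero_iff] at this
    rw [hf, h0] at hv
    simpa using hv
  exact ⟨LinearEquiv.ofInjectiveEndo f hinj, hxf⟩

theorem card_linearMap_range_eq_congr {E : Type*} [AddCommGroup E] [Module K E]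
    [FiniteDimensional K E] (x : E →ₗ[K] V) (W W' : Submodule K V) (t : ℕ)
    (hW : Module.finrank K W = Module.finrank K W')
    (hWU : Module.finrank K (W ⊓ LinearMap.range x : Submodule K V) =
      Module.finrank K (W' ⊓ LinearMap.range x : Submodule K V)) :
    Nat.card {f : E →ₗ[K] V // Module.finrank K (LinearMap.range f) = t ∧
        LinearMap.range (x + f) = W} =
      Nat.card {f : E →ₗ[K] V // Module.finrank K (LinearMap.range f) = t ∧
        LinearMap.range (x + f) = W'} := by
  obtain ⟨g, hgU, hgW⟩ := exists_linearEquiv_map_eq_map_eq (LinearMap.range x) W W' hW hWU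
  obtain ⟨e, he⟩ := exists_linearEquiv_comp_eq x g hgU
  have hx : e.arrowCongr g x = x := by
    ext v
    rw [LinearEquiv.arrowCongr_apply, ← he, e.apply_symm_apply]
  have hrange (f : E →ₗ[K] V) :
      LinearMap.range (e.arrowCongr g f) = Submodule.map (g : V →ₗ[K] V) (LinearMap.range f) := by
    change LinearMap.range ((g : V →ₗ[K] V) ∘ₗ f ∘ₗ (e.symm : E →ₗ[K] E)) = _
    rw [LinearMap.range_comp, LinearMap.range_comp_of_range_eq_top _ e.symm.range]
  refine Nat.card_congr ((e.arrowCongr g).toEquiv.subtypeEquiv fun f => ?_)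
  change _ ↔ Module.finrank K (LinearMap.range (e.arrowCongr g f)) = t ∧
    LinearMap.range (x + e.arrowCongr g f) = W'
  have hadd : x + e.arrowCongr g f = e.arrowCongr g (x + f) := by rw [map_add, hx]
  rw [hadd, hrange, hrange, ← hgW, LinearEquiv.finrank_map_eq,
    (Submodule.map_injective_of_injective g.injective).eq_iff]

end Transitivity

section Matrices

variable {F : Type*} [Field F] {n m : ℕ}

theorem rank_eq_finrank_rowSpace (M : Matrix (Fin n) (Fin m) F) :
    M.rank = Module.finrank F (rowSpace M) := by
  rw [rowSpace, range_vecMulLinear, Matrix.rank_eq_finrank_span_row]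

theorem card_rank_eq_rowSpace_eq_congr (X : Matrix (Fin n) (Fin m) F)
    (W W' : Submodule F (Fin m → F)) (t : ℕ)
    (hW : Module.finrank F W = Module.finrank F W')
    (hWX : Module.finrank F (W ⊓ rowSpace X : Submodule F (Fin m → F)) =
      Module.finrank F (W' ⊓ rowSpace X : Submodule F (Fin m → F))) :
    Nat.card {B : Matrix (Fin n) (Fin m) F // B.rank = t ∧ rowSpace (X + B) = W} =
      Nat.card {B : Matrix (Fin n) (Fin m) F // B.rank = t ∧ rowSpace (X + B) = W'} := by
  have h (W : Submodule F (Fin m → F)) :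
      Nat.card {B : Matrix (Fin n) (Fin m) F // B.rank = t ∧ rowSpace (X + B) = W} =
        Nat.card {f : (Fin n → F) →ₗ[F] (Fin m → F) //
          Module.finrank F (LinearMap.range f) = t ∧
            LinearMap.range (X.vecMulLinear + f) = W} := by
    refine Nat.card_congr (Matrix.toLinearMapRight'.toEquiv.subtypeEquiv fun B => ?_)
    have hadd : (X + B).vecMulLinear = X.vecMulLinear + B.vecMulLinear :=
      map_add Matrix.toLinearMapRight' X B
    rw [rank_eq_finrank_rowSpace, rowSpace, rowSpace, hadd]
    rfl
  rw [h, h]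
  exact card_linearMap_range_eq_congr _ W W' t hW hWX

end Matrices

/-- decomposition of the count of matrices `B` with `rank B = r_B` and
`rank (X + B) = r` according to the dimension `h` of the intersection of `row(X + B)`
with `row(X)`, using representative subspaces `V_h`. -/
theorem count_rank_sums_decomposition
    (q n m : ℕ) (hn : 0 < n) (hm : 0 < m)
    (F : Type*) [Field F] [Fintype F] (hq : Fintype.card F = q)
    (X : Matrix (Fin n) (Fin m) F) (rX : ℕ) (hX : X.rank = rX)
    (r rB : ℕ) (hr : r ≤ m)
    (V : ℕ → Submodule F (Fin m → F))
    (hV : ∀ h ∈ Finset.Icc (r - (m - rX)) (min r rX),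
      Module.finrank F (V h) = r ∧
      Module.finrank F ((V h) ⊓ rowSpace X : Submodule F (Fin m → F)) = h) :
    Nat.card {B : Matrix (Fin n) (Fin m) F // B.rank = rB ∧ (X + B).rank = r} =
      ∑ h ∈ Finset.Icc (r - (m - rX)) (min r rX),
        q ^ ((r - h) * (rX - h)) * gaussBinom q (m - rX) (r - h) * gaussBinom q rX h *
          Nat.card {B : Matrix (Fin n) (Fin m) F //
            B.rank = rB ∧ rowSpace (X + B) = V h} := by
  classical
  have hq' : Nat.card F = q := by rw [Nat.card_eq_fintype_card, hq]
  have hXd : Module.finrank F (rowSpace X) = rX := by rw [← rank_eq_finrank_rowSpace, hX]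
  have hsum : Nat.card {B : Matrix (Fin n) (Fin m) F // B.rank = rB ∧ (X + B).rank = r} =
      ∑ W ∈ Finset.univ.filter fun W : Submodule F (Fin m → F) => Module.finrank F W = r,
        Nat.card {B : Matrix (Fin n) (Fin m) F // B.rank = rB ∧ rowSpace (X + B) = W} := by
    simp only [Nat.card_eq_fintype_card, Fintype.card_subtype]
    rw [Finset.card_eq_sum_card_fiberwise (f := fun B => rowSpace (X + B))
      (t := Finset.univ.filter fun W : Submodule F (Fin m → F) => Module.finrank F W = r)]
    · refine Finset.sum_congr rfl fun W hW => ?_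
      rw [Finset.filter_filter]
      congr 1
      ext B
      simp only [Finset.mem_filter, Finset.mem_univ, true_and] at hW ⊢
      refine ⟨fun h => ⟨h.1.1, h.2⟩, fun h => ⟨⟨h.1, ?_⟩, h.2⟩⟩
      rw [rank_eq_finrank_rowSpace, h.2, hW]
    · intro B hB
      simp only [Finset.coe_filter, Finset.mem_univ, true_and, Set.mem_ofPred_eq] at hB ⊢
      rw [← rank_eq_finrank_rowSpace, hB.2]
  rw [hsum, ← Finset.sum_fiberwise_of_maps_to
    (g := fun W : Submodule F (Fin m → F) =>
      Module.finrank F (W ⊓ rowSpace X : Submodule F (Fin m → F)))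
    (t := Finset.Icc (r - (m - rX)) (min r rX))]
  · refine Finset.sum_congr rfl fun h hh => ?_
    obtain ⟨hVr, hVh⟩ := hV h hh
    rw [Finset.sum_congr rfl (g := fun _ => Nat.card {B : Matrix (Fin n) (Fin m) F //
      B.rank = rB ∧ rowSpace (X + B) = V h})]
    · rw [Finset.sum_const, smul_eq_mul, Finset.filter_filter]
      congr 1
      rw [Finset.mem_Icc, le_min_iff] at hh
      have hcard := card_submodule_inf (rowSpace X) (hXd ▸ hh.2.2) (r - h)
      rw [Nat.add_sub_cancel' hh.2.1, hXd, hq', Module.finrank_fin_fun,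
        Nat.card_eq_fintype_card, Fintype.card_subtype] at hcard
      exact hcard
    · intro W hW
      simp only [Finset.mem_filter, Finset.mem_univ, true_and] at hW
      exact card_rank_eq_rowSpace_eq_congr X W (V h) rB (hW.1.trans hVr.symm)
        (hW.2.trans hVh.symm)
  · intro W hW
    simp only [Finset.mem_filter, Finset.mem_univ, true_and] at hW
    have h1 := Submodule.finrank_sup_add_finrank_inf_eq W (rowSpace X)
    have h2 := Submodule.finrank_le (W ⊔ rowSpace X)
    have h3 := Submodule.finrank_mono (inf_le_left : W ⊓ rowSpace X ≤ W)
    have h4 := Submodule.finrank_mono (inf_le_right : W ⊓ rowSpace X ≤ rowSpace X)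
    rw [Module.finrank_fin_fun] at h2
    rw [Finset.mem_Icc]
    omega
end

section
/- Let n, m be positive integers. Let X and B be independent random matrices in F_q^{n×m}, each distributed Uniform Given Rank, and let A be a random matrix distributed uniformly on GL(n,q), independent of X and B. Then the distribution of Y = A(X + B) is Uniform Given Rank; that is, for all matrices Y₁, Y₂ ∈ F_q^{n×m} with rank(Y₁) = rank(Y₂), Prob(A(X + B) = Y₁) = Prob(A(X + B) = Y₂). -/
/-- Two linear maps whose ranges have the same dimension differ by automorphisms of the domain and
of the codomain. -/
theorem LinearMap.exists_linearEquiv_comp_eq_of_finrank_range_eq {K V W : Type*} [Field K]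
    [AddCommGroup V] [Module K V] [FiniteDimensional K V]
    [AddCommGroup W] [Module K W] [FiniteDimensional K W]
    (f g : V →ₗ[K] W)
    (h : Module.finrank K (LinearMap.range f) = Module.finrank K (LinearMap.range g)) :
    ∃ (e : V ≃ₗ[K] V) (e' : W ≃ₗ[K] W), e'.toLinearMap ∘ₗ f = g ∘ₗ e.toLinearMap := by
  obtain ⟨C, hC⟩ := Submodule.exists_isCompl (LinearMap.ker f)
  obtain ⟨D, hD⟩ := Submodule.exists_isCompl (LinearMap.ker g)
  have hker : Module.finrank K (LinearMap.ker f) = Module.finrank K (LinearMap.ker g) := by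
    have hf := f.finrank_range_add_finrank_ker
    have hg := g.finrank_range_add_finrank_ker
    omega
  let κ := LinearEquiv.ofFinrankEq _ _ hker
  let φ := LinearEquiv.ofFinrankEq _ _ h
  let ψ : C ≃ₗ[K] D :=
    f.kerComplementEquivRange hC.symm ≪≫ₗ φ ≪≫ₗ (g.kerComplementEquivRange hD.symm).symm
  obtain ⟨e', he'⟩ := Submodule.exists_linearEquiv_restrict_eq φ
  refine ⟨(Submodule.prodEquivOfIsCompl _ _ hC).symm ≪≫ₗ κ.prodCongr ψ ≪≫ₗ
    Submodule.prodEquivOfIsCompl _ _ hD, e', ?_⟩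
  have hψ (c : C) : g (ψ c) = φ (f.kerComplementEquivRange hC.symm c) := by
    change ((g.kerComplementEquivRange hD.symm (ψ c) : LinearMap.range g) : W) = _
    simp only [ψ, LinearEquiv.trans_apply, LinearEquiv.apply_symm_apply]
  ext v
  obtain ⟨⟨k, c⟩, rfl⟩ := (Submodule.prodEquivOfIsCompl _ _ hC).surjective v
  have hk : g (κ k) = 0 := (κ k).2
  have hc : ((f.kerComplementEquivRange hC.symm c : LinearMap.range f) : W) = f c := rfl
  simp [hk, hψ, he', hc]

/-- Matrices over a field of the same shape and rank are equivalent. -/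
theorem Matrix.exists_mul_mul_eq_of_rank_eq {m n K : Type*} [Fintype m] [DecidableEq m]
    [Fintype n] [DecidableEq n] [Field K] (A B : Matrix m n K) (h : A.rank = B.rank) :
    ∃ (P : GL m K) (Q : GL n K), (P : Matrix m m K) * A * (Q : Matrix n n K) = B := by
  obtain ⟨e, e', he⟩ := LinearMap.exists_linearEquiv_comp_eq_of_finrank_range_eq
    A.mulVecLin B.mulVecLin h
  let P : GL m K := Matrix.GeneralLinearGroup.toLin.symm
    ((LinearMap.GeneralLinearGroup.generalLinearEquiv K _).symm e')
  let Q : GL n K := Matrix.GeneralLinearGroup.toLin.symm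
    ((LinearMap.GeneralLinearGroup.generalLinearEquiv K _).symm e)
  have hP : (P : Matrix m m K) = LinearMap.toMatrix' e'.toLinearMap := rfl
  have hQ : (Q : Matrix n n K) = LinearMap.toMatrix' e.toLinearMap := rfl
  have hPQ : (P : Matrix m m K) * A = B * (Q : Matrix n n K) := by
    have := congrArg LinearMap.toMatrix' he
    rwa [LinearMap.toMatrix'_comp, LinearMap.toMatrix'_comp, ← Matrix.toLin'_apply',
      ← Matrix.toLin'_apply', LinearMap.toMatrix'_toLin', LinearMap.toMatrix'_toLin',
      ← hP, ← hQ] at this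
  refine ⟨P, Q⁻¹, ?_⟩
  rw [hPQ, Matrix.mul_assoc, ← Units.val_mul, mul_inv_cancel, Units.val_one, Matrix.mul_one]

/-- Right multiplication by an invertible matrix, as a permutation of rectangular matrices. -/
@[simps]
def Matrix.mulRightEquivOfGL {m n K : Type*} [Fintype n] [DecidableEq n] [CommRing K]
    (Q : GL n K) : Matrix m n K ≃ Matrix m n K where
  toFun M := M * (Q : Matrix n n K)
  invFun M := M * ((Q⁻¹ : GL n K) : Matrix n n K)
  left_inv M := by
    beta_reduce
    rw [Matrix.mul_assoc, ← Units.val_mul, mul_inv_cancel, Units.val_one, Matrix.mul_one]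
  right_inv M := by
    beta_reduce
    rw [Matrix.mul_assoc, ← Units.val_mul, inv_mul_cancel, Units.val_one, Matrix.mul_one]


/-- if `X` and `B` are independent Uniform Given Rank random matrices and
`A` is uniform on `GL(n,q)` (independent of both), then `Y = A(X + B)` is Uniform Given
Rank. -/
theorem output_is_UGR
    (q n m : ℕ) (hn : 0 < n) (hm : 0 < m)
    (F : Type*) [Field F] [Fintype F] [DecidableEq F] (hq : Fintype.card F = q)
    (pX pB : Matrix (Fin n) (Fin m) F → ℝ)
    (hpX0 : ∀ M, 0 ≤ pX M) (hpX1 : ∑ M : Matrix (Fin n) (Fin m) F, pX M = 1)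
    (hpB0 : ∀ M, 0 ≤ pB M) (hpB1 : ∑ M : Matrix (Fin n) (Fin m) F, pB M = 1)
    -- both distributions are Uniform Given Rank
    (hpXUGR : ∀ M M' : Matrix (Fin n) (Fin m) F, M.rank = M'.rank → pX M = pX M')
    (hpBUGR : ∀ M M' : Matrix (Fin n) (Fin m) F, M.rank = M'.rank → pB M = pB M') :
    ∀ Y₁ Y₂ : Matrix (Fin n) (Fin m) F, Y₁.rank = Y₂.rank →
      (∑ A₀ : GL (Fin n) F, ∑ X₀ : Matrix (Fin n) (Fin m) F,
          ∑ B₀ : Matrix (Fin n) (Fin m) F,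
          (if (A₀ : Matrix (Fin n) (Fin n) F) * (X₀ + B₀) = Y₁ then
            (1 / (Fintype.card (GL (Fin n) F) : ℝ)) * pX X₀ * pB B₀ else 0)) =
      ∑ A₀ : GL (Fin n) F, ∑ X₀ : Matrix (Fin n) (Fin m) F,
          ∑ B₀ : Matrix (Fin n) (Fin m) F,
          (if (A₀ : Matrix (Fin n) (Fin n) F) * (X₀ + B₀) = Y₂ then
            (1 / (Fintype.card (GL (Fin n) F) : ℝ)) * pX X₀ * pB B₀ else 0) := by
  intro Y₁ Y₂ hY
  obtain ⟨P, Q, hPQ⟩ := Matrix.exists_mul_mul_eq_of_rank_eq Y₁ Y₂ hY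
  have hQ : IsUnit (Q : Matrix (Fin m) (Fin m) F).det :=
    (Matrix.isUnit_iff_isUnit_det _).1 Q.isUnit
  refine Fintype.sum_equiv (Equiv.mulLeft P) _ _ fun A₀ => ?_
  refine Fintype.sum_equiv (Matrix.mulRightEquivOfGL Q) _ _ fun X₀ => ?_
  refine Fintype.sum_equiv (Matrix.mulRightEquivOfGL Q) _ _ fun B₀ => ?_
  have hX : pX (X₀ * (Q : Matrix (Fin m) (Fin m) F)) = pX X₀ :=
    hpXUGR _ _ (Matrix.rank_mul_eq_left_of_isUnit_det _ _ hQ)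
  have hB : pB (B₀ * (Q : Matrix (Fin m) (Fin m) F)) = pB B₀ :=
    hpBUGR _ _ (Matrix.rank_mul_eq_left_of_isUnit_det _ _ hQ)
  have hinj : Function.Injective fun M : Matrix (Fin n) (Fin m) F =>
      (P : Matrix (Fin n) (Fin n) F) * M * (Q : Matrix (Fin m) (Fin m) F) := by
    intro M N hMN
    have hPM := (Matrix.mulRightEquivOfGL Q).injective hMN
    have := congrArg (fun Z => ((P⁻¹ : GL (Fin n) F) : Matrix (Fin n) (Fin n) F) * Z) hPM
    simpa only [← Matrix.mul_assoc, ← Units.val_mul, inv_mul_cancel, Units.val_one,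
      Matrix.one_mul] using this
  have hiff : ((Equiv.mulLeft P A₀ : GL (Fin n) F) : Matrix (Fin n) (Fin n) F) *
      (Matrix.mulRightEquivOfGL Q X₀ + Matrix.mulRightEquivOfGL Q B₀) = Y₂ ↔
      (A₀ : Matrix (Fin n) (Fin n) F) * (X₀ + B₀) = Y₁ := by
    rw [← hPQ, ← hinj.eq_iff (b := Y₁)]
    simp only [Equiv.coe_mulLeft, Units.val_mul, Matrix.mulRightEquivOfGL_apply,
      ← Matrix.add_mul, Matrix.mul_assoc]
  simp only [hiff]
  simp only [Matrix.mulRightEquivOfGL_apply, hX, hB]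
end
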